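/- The modified elliptic K-operator of type I, K_k(ξ)f(z) = σ_{2ξ}(z + (ξ+ν)/k)f(z + 2ξ/k) − σ_{2ν}(z + (ξ+ν)/k)f(−z − 2ν/k), preserves the space V_k. -/

import Mathlib

open Complex

/-- Jacobi theta function `θ₁(z,τ) = Σ_{n∈ℤ+1/2} exp(iπn²τ + 2πin(z+1/2))`. -/
noncomputable def theta1 (z τ : ℂ) : ℂ :=
  ∑' n : ℤ, Complex.exp (Real.pi * I * ((n : ℂ) + 1/2)^2 * τ +
    2 * Real.pi * I * ((n : ℂ) + 1/2) * (z + 1/2))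

/-- `θ₁′(0,τ)`, the derivative of `θ₁` in the first variable at `0`. -/
noncomputable def theta1'0 (τ : ℂ) : ℂ := deriv (fun w => theta1 w τ) 0

/-- The function `σ_μ(z) = θ₁(z−μ,τ)θ₁′(0,τ)/(θ₁(z,τ)θ₁(−μ,τ))`. -/
noncomputable def sigmaE (τ μ z : ℂ) : ℂ :=
  theta1 (z - μ) τ * theta1'0 τ / (theta1 z τ * theta1 (-μ) τ)

/-- The lattice `ℤ + τℤ`. -/
def lattice (τ : ℂ) : Set ℂ := {w | ∃ m n : ℤ, w = (m : ℂ) + (n : ℂ) * τ}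

/-- The space V_k of entire functions with f(z+1) = f(z) and
f(z+τ) = e^{−2πikz−πikτ} f(z). -/
def VkSet (τ : ℂ) (k : ℕ) : Set (ℂ → ℂ) :=
  {f | Differentiable ℂ f ∧ (∀ z, f (z + 1) = f z) ∧
    ∀ z, f (z + τ) = Complex.exp (-2 * Real.pi * I * k * z - Real.pi * I * k * τ) * f z}

open Filter Topology

/-- The translations under which `H` is multiplied by a nowhere vanishing entire function. -/
def quasiPeriods (H : ℂ → ℂ) : AddSubgroup ℂ where
  carrier := {s | ∃ e : ℂ → ℂ, Differentiable ℂ e ∧ (∀ z, e z ≠ 0) ∧ ∀ z, H (z + s) = e z * H z}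
  zero_mem' := ⟨fun _ => 1, by fun_prop, by simp, by simp⟩
  add_mem' := by
    rintro s t ⟨e, he, he0, hs⟩ ⟨e', he', he0', ht⟩
    refine ⟨fun z => e' (z + s) * e z, by fun_prop, fun z => mul_ne_zero (he0' _) (he0 _),
      fun z => ?_⟩
    rw [← add_assoc, ht, hs, mul_assoc]
  neg_mem' := by
    rintro s ⟨e, he, he0, hs⟩
    refine ⟨fun z => (e (z + -s))⁻¹, fun z => ?_, fun z => inv_ne_zero (he0 _), fun z => ?_⟩
    · have h : DifferentiableAt ℂ (fun z => e (z + -s)) z := by fun_prop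
      exact h.inv (he0 _)
    · have h := hs (z + -s)
      rw [neg_add_cancel_right] at h
      rw [h, inv_mul_cancel_left₀ (he0 _)]

lemma mem_of_mem_lattice {S : AddSubgroup ℂ} {τ w : ℂ} (h1 : (1 : ℂ) ∈ S) (hτ : τ ∈ S)
    (hw : w ∈ lattice τ) : w ∈ S := by
  obtain ⟨m, n, rfl⟩ := hw
  have hm := S.zsmul_mem h1 m
  have hn := S.zsmul_mem hτ n
  simp only [zsmul_eq_mul, mul_one] at hm hn
  exact S.add_mem hm hn

lemma eq_zero_of_mem_quasiPeriods {H : ℂ → ℂ} {s : ℂ} (hs : s ∈ quasiPeriods H) (h0 : H 0 = 0) :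
    H s = 0 := by
  obtain ⟨e, -, -, h⟩ := hs
  simpa [h0] using h 0

lemma deriv_ne_zero_of_mem_quasiPeriods {H : ℂ → ℂ} (hH : Differentiable ℂ H) {s : ℂ}
    (hs : s ∈ quasiPeriods H) (h0 : H 0 = 0) (h1 : deriv H 0 ≠ 0) : deriv H s ≠ 0 := by
  obtain ⟨e, he, he0, h⟩ := hs
  have key : deriv (fun z => H (z + s)) 0 = deriv (fun z => e z * H z) 0 := by simp_rw [h]
  rw [deriv_comp_add_const, zero_add, deriv_fun_mul (he 0) (hH 0), h0, mul_zero, zero_add] at key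
  rw [key]
  exact mul_ne_zero (he0 0) h1

lemma countable_lattice (τ : ℂ) : (lattice τ).Countable := by
  have : lattice τ = Set.range fun p : ℤ × ℤ => (p.1 : ℂ) + (p.2 : ℂ) * τ := by
    ext w
    simp [lattice, eq_comm]
  rw [this]
  exact Set.countable_range _

/-- Entire functions can be divided when the zeros of the denominator are simple and are
also zeros of the numerator. -/
lemma exists_entire_quotient {G T : ℂ → ℂ} (hG : Differentiable ℂ G) (hT : Differentiable ℂ T)
    (h : ∀ z, T z = 0 → G z = 0 ∧ deriv T z ≠ 0) :
    ∃ F : ℂ → ℂ, Differentiable ℂ F ∧ ∀ z, G z = F z * T z := by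
  classical
  refine ⟨fun z => if T z = 0 then deriv G z / deriv T z else G z / T z, fun z₀ => ?_,
    fun z => ?_⟩
  · by_cases hz : T z₀ = 0
    · obtain ⟨hG0, hT1⟩ := h z₀ hz
      have dG : Differentiable ℂ (dslope G z₀) := differentiableOn_univ.1
        ((Complex.differentiableOn_dslope univ_mem).2 hG.differentiableOn)
      have dT : Differentiable ℂ (dslope T z₀) := differentiableOn_univ.1
        ((Complex.differentiableOn_dslope univ_mem).2 hT.differentiableOn)
      have hne : dslope T z₀ z₀ ≠ 0 := by rwa [dslope_same]
      refine ((dG z₀).div (dT z₀) hne).congr_of_eventuallyEq ?_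
      filter_upwards [(dT z₀).continuousAt.eventually_ne hne] with z hzne
      rcases eq_or_ne z z₀ with rfl | hzz
      · simp [hz]
      · have h1 := sub_smul_dslope T z₀ z
        have h2 := sub_smul_dslope G z₀ z
        rw [hz, sub_zero, smul_eq_mul] at h1
        rw [hG0, sub_zero, smul_eq_mul] at h2
        have hs : z - z₀ ≠ 0 := sub_ne_zero.2 hzz
        rw [if_neg (h1 ▸ mul_ne_zero hs hzne), ← h1, ← h2, mul_div_mul_left _ _ hs, Pi.div_apply]
    · refine ((hG z₀).div (hT z₀) hz).congr_of_eventuallyEq ?_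
      filter_upwards [(hT z₀).continuousAt.eventually_ne hz] with z hz'
      rw [if_neg hz', Pi.div_apply]
  · dsimp only
    split_ifs with hz
    · rw [(h z hz).1, hz, mul_zero]
    · rw [div_mul_cancel₀ _ hz]

lemma eq_of_mul_eq_mul_of_zeros_countable {A B T : ℂ → ℂ} (hA : Continuous A) (hB : Continuous B)
    {L : Set ℂ} (hL : L.Countable) (hT : ∀ z, T z = 0 → z ∈ L)
    (h : ∀ z, A z * T z = B z * T z) : A = B := by
  refine hA.ext_on (hL.dense_compl ℝ) hB fun z hz => ?_
  exact mul_right_cancel₀ (fun h0 => hz (hT z h0)) (h z)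

lemma eq_const_of_doubly_periodic {τ : ℂ} (hτ : 0 < τ.im) {F : ℂ → ℂ} (hF : Differentiable ℂ F)
    (h1 : ∀ z, F (z + 1) = F z) (h2 : ∀ z, F (z + τ) = F z) (z : ℂ) : F z = F 0 := by
  let L : PeriodPair := ⟨1, τ, by
    rw [LinearIndependent.pair_iff]
    intro s t hst
    have him := congrArg Complex.im hst
    have hre := congrArg Complex.re hst
    simp at him hre
    rcases him with rfl | h
    · simpa using hre
    · exact absurd h hτ.ne'⟩
  have hper : ∀ z w, w ∈ L.lattice → F (z + w) = F z := by
    intro z w hw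
    obtain ⟨m, n, rfl⟩ := PeriodPair.mem_lattice.1 hw
    have hm : Function.Periodic F ((m : ℂ) * 1) := Function.Periodic.int_mul h1 m
    have hn : Function.Periodic F ((n : ℂ) * τ) := Function.Periodic.int_mul h2 n
    rw [← add_assoc]
    exact (hn _).trans (hm z)
  exact hF.apply_eq_apply_of_bounded
    (IsZLattice.isCompact_range_of_periodic L.lattice F hF.continuous hper).isBounded z 0

/-- The infinite product `∏ (1 - Qⁿ x)` over `n ≥ 0`. -/
noncomputable def qProd (Q x : ℂ) : ℂ := ∏' n : ℕ, (1 + -(Q ^ n * x))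

section qProd

variable {Q : ℂ}

lemma summable_norm_qProd (hQ : ‖Q‖ < 1) (x : ℂ) : Summable fun n : ℕ => ‖-(Q ^ n * x)‖ := by
  simpa using (summable_geometric_of_lt_one (norm_nonneg Q) hQ).mul_right ‖x‖

lemma qProd_eq (hQ : ‖Q‖ < 1) (x : ℂ) : qProd Q x = (1 - x) * qProd Q (Q * x) := by
  have h : Multipliable fun n : ℕ => 1 + -(Q ^ (n + 1) * x) := by
    refine multipliable_one_add_of_summable ?_
    exact (summable_nat_add_iff (f := fun n : ℕ => ‖-(Q ^ n * x)‖) 1).2 (summable_norm_qProd hQ x)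
  have h' := tprod_eq_zero_mul' (f := fun n : ℕ => 1 + -(Q ^ n * x)) h
  simp only [pow_zero, one_mul, pow_succ, mul_assoc] at h'
  rw [qProd, qProd, h', sub_eq_add_neg]

lemma exists_pow_mul_eq_one_of_qProd_eq_zero (hQ : ‖Q‖ < 1) {x : ℂ} (h : qProd Q x = 0) :
    ∃ n : ℕ, Q ^ n * x = 1 := by
  by_contra! hne
  refine tprod_one_add_ne_zero_of_summable (fun n => ?_) (summable_norm_qProd hQ x) h
  rw [← sub_eq_add_neg]
  exact sub_ne_zero.2 (hne n).symm

lemma differentiable_qProd (hQ : ‖Q‖ < 1) : Differentiable ℂ (qProd Q) := by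
  intro x₀
  have hB : IsOpen (Metric.ball (0 : ℂ) (‖x₀‖ + 1)) := Metric.isOpen_ball
  have hp := Summable.hasProdLocallyUniformlyOn_nat_one_add (f := fun n x => -(Q ^ n * x)) hB
    ((summable_geometric_of_lt_one (norm_nonneg Q) hQ).mul_right (‖x₀‖ + 1))
    (.of_forall fun n x hx => by
      rw [norm_neg, norm_mul, norm_pow]
      have : ‖x‖ < ‖x₀‖ + 1 := by simpa using hx
      gcongr)
    (fun n => by fun_prop)
  have hd := hp.differentiableOn (.of_forall fun s => by
    simpa [Finset.prod_fn] using DifferentiableOn.finsetProd (fun _ _ => by fun_prop)) hB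
  exact hd.differentiableAt (hB.mem_nhds (by simp))

end qProd

/-- The product side of the Jacobi triple product, normalised to be `1`-periodic. -/
noncomputable def thetaProd (τ z : ℂ) : ℂ :=
  qProd (cexp (2 * Real.pi * I * τ)) (cexp (2 * Real.pi * I * z)) *
    qProd (cexp (2 * Real.pi * I * τ)) (cexp (2 * Real.pi * I * (τ - z)))

section thetaProd

variable {τ : ℂ}

lemma norm_nome_lt_one (hτ : 0 < τ.im) : ‖cexp (2 * Real.pi * I * τ)‖ < 1 := by
  simpa using UpperHalfPlane.norm_exp_two_pi_I_lt_one ⟨τ, hτ⟩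

lemma exists_int_of_exp_two_pi_I_mul_eq_one {w : ℂ} (h : cexp (2 * Real.pi * I * w) = 1) :
    ∃ m : ℤ, w = m := by
  obtain ⟨m, hm⟩ := Complex.exp_eq_one_iff.1 h
  refine ⟨m, mul_left_cancel₀ Complex.two_pi_I_ne_zero ?_⟩
  rw [hm, mul_comm]

lemma exp_two_pi_I_mul_add_one (z : ℂ) :
    cexp (2 * Real.pi * I * (z + 1)) = cexp (2 * Real.pi * I * z) := by
  rw [mul_add, mul_one, Complex.exp_add, Complex.exp_two_pi_mul_I, mul_one]

lemma differentiable_thetaProd (hτ : 0 < τ.im) : Differentiable ℂ (thetaProd τ) := by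
  have h := differentiable_qProd (norm_nome_lt_one hτ)
  unfold thetaProd
  fun_prop

lemma thetaProd_add_one (z : ℂ) : thetaProd τ (z + 1) = thetaProd τ z := by
  have h := exp_two_pi_I_mul_add_one (τ - (z + 1))
  rw [show τ - (z + 1) + 1 = τ - z by ring] at h
  rw [thetaProd, thetaProd, exp_two_pi_I_mul_add_one, h]

lemma thetaProd_eq (hτ : 0 < τ.im) (z : ℂ) :
    thetaProd τ z = (1 - cexp (2 * Real.pi * I * z)) *
      (qProd (cexp (2 * Real.pi * I * τ)) (cexp (2 * Real.pi * I * (τ + z))) *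
        qProd (cexp (2 * Real.pi * I * τ)) (cexp (2 * Real.pi * I * (τ - z)))) := by
  rw [thetaProd, qProd_eq (norm_nome_lt_one hτ) (cexp (2 * Real.pi * I * z)), ← Complex.exp_add,
    ← mul_add, mul_assoc]

lemma thetaProd_add_tau (hτ : 0 < τ.im) (z : ℂ) :
    thetaProd τ (z + τ) = -cexp (-(2 * Real.pi * I * z)) * thetaProd τ z := by
  rw [thetaProd_eq hτ z, thetaProd,
    qProd_eq (norm_nome_lt_one hτ) (cexp (2 * Real.pi * I * (τ - (z + τ)))), ← Complex.exp_add,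
    ← mul_add, show τ - (z + τ) = -z by ring, show τ + -z = τ - z by ring, add_comm z τ, mul_neg]
  have h : cexp (-(2 * Real.pi * I * z)) * cexp (2 * Real.pi * I * z) = 1 := by
    rw [← Complex.exp_add, neg_add_cancel, Complex.exp_zero]
  linear_combination -(qProd (cexp (2 * Real.pi * I * τ)) (cexp (2 * Real.pi * I * (τ + z))) *
    qProd (cexp (2 * Real.pi * I * τ)) (cexp (2 * Real.pi * I * (τ - z)))) * h

lemma mem_lattice_of_thetaProd_eq_zero (hτ : 0 < τ.im) {z : ℂ} (h : thetaProd τ z = 0) :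
    z ∈ lattice τ := by
  rcases mul_eq_zero.1 h with h | h <;>
    obtain ⟨n, hn⟩ := exists_pow_mul_eq_one_of_qProd_eq_zero (norm_nome_lt_one hτ) h
  · rw [← Complex.exp_nat_mul, ← Complex.exp_add, mul_left_comm, ← mul_add] at hn
    obtain ⟨m, hm⟩ := exists_int_of_exp_two_pi_I_mul_eq_one hn
    exact ⟨m, -n, by push_cast; linear_combination hm⟩
  · rw [← Complex.exp_nat_mul, ← Complex.exp_add, mul_left_comm, ← mul_add] at hn
    obtain ⟨m, hm⟩ := exists_int_of_exp_two_pi_I_mul_eq_one hn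
    exact ⟨-m, n + 1, by push_cast; linear_combination -hm⟩

lemma thetaProd_zero (hτ : 0 < τ.im) : thetaProd τ 0 = 0 := by
  simp [thetaProd_eq hτ]

lemma deriv_thetaProd_zero_ne_zero (hτ : 0 < τ.im) : deriv (thetaProd τ) 0 ≠ 0 := by
  have hQ := norm_nome_lt_one hτ
  have hd := differentiable_qProd hQ
  rw [show thetaProd τ = _ from funext (thetaProd_eq hτ),
    deriv_fun_mul (by fun_prop) (by fun_prop)]
  have h1 : deriv (fun z => 1 - cexp (2 * Real.pi * I * z)) 0 = -(2 * Real.pi * I) := by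
    have h : HasDerivAt (fun z : ℂ => 1 - cexp (2 * Real.pi * I * z))
        (-(cexp (2 * Real.pi * I * 0) * (2 * Real.pi * I * 1))) 0 :=
      (((hasDerivAt_id (0 : ℂ)).const_mul (2 * Real.pi * I)).cexp).const_sub 1
    simpa using h.deriv
  have h2 : qProd (cexp (2 * Real.pi * I * τ)) (cexp (2 * Real.pi * I * τ)) ≠ 0 := by
    intro h
    obtain ⟨n, hn⟩ := exists_pow_mul_eq_one_of_qProd_eq_zero hQ h
    rw [← pow_succ] at hn
    have := pow_lt_one₀ (norm_nonneg _) hQ n.succ_ne_zero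
    rw [← norm_pow, hn, norm_one] at this
    exact lt_irrefl _ this
  rw [h1]
  simpa using h2

lemma deriv_thetaProd_ne_zero (hτ : 0 < τ.im) {z : ℂ} (hz : z ∈ lattice τ) :
    deriv (thetaProd τ) z ≠ 0 := by
  refine deriv_ne_zero_of_mem_quasiPeriods (differentiable_thetaProd hτ)
    (mem_of_mem_lattice ?_ ?_ hz) (thetaProd_zero hτ) (deriv_thetaProd_zero_ne_zero hτ)
  · exact ⟨fun _ => 1, by fun_prop, by simp, fun z => by simp [thetaProd_add_one]⟩
  · exact ⟨fun z => -cexp (-(2 * Real.pi * I * z)), by fun_prop, by simp, thetaProd_add_tau hτ⟩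

end thetaProd

section theta1

variable {τ : ℂ}

lemma theta1_eq_jacobiTheta₂ (z τ : ℂ) :
    theta1 z τ = cexp (Real.pi * I * (τ / 4 + z + 1 / 2)) * jacobiTheta₂ (z + 1 / 2 + τ / 2) τ := by
  rw [theta1, jacobiTheta₂, ← tsum_mul_left]
  refine tsum_congr fun n => ?_
  rw [jacobiTheta₂_term, ← Complex.exp_add]
  ring_nf

lemma differentiable_theta1 (hτ : 0 < τ.im) : Differentiable ℂ fun z => theta1 z τ := by
  have h : Differentiable ℂ fun z => jacobiTheta₂ z τ :=
    fun z => differentiableAt_jacobiTheta₂_fst z hτ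
  simp_rw [theta1_eq_jacobiTheta₂]
  have h' : Differentiable ℂ fun z => jacobiTheta₂ (z + 1 / 2 + τ / 2) τ :=
    h.comp (f := fun z => z + 1 / 2 + τ / 2) (by fun_prop)
  fun_prop

lemma theta1_add_one (z : ℂ) : theta1 (z + 1) τ = -theta1 z τ := by
  rw [theta1_eq_jacobiTheta₂, theta1_eq_jacobiTheta₂,
    show z + 1 + 1 / 2 + τ / 2 = z + 1 / 2 + τ / 2 + 1 by ring, jacobiTheta₂_add_left,
    show (Real.pi : ℂ) * I * (τ / 4 + (z + 1) + 1 / 2) =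
      Real.pi * I * (τ / 4 + z + 1 / 2) + Real.pi * I by ring, Complex.exp_add, Complex.exp_pi_mul_I]
  ring

lemma theta1_add_tau (z : ℂ) :
    theta1 (z + τ) τ = -cexp (-(Real.pi * I * (τ + 2 * z))) * theta1 z τ := by
  rw [theta1_eq_jacobiTheta₂, theta1_eq_jacobiTheta₂,
    show z + τ + 1 / 2 + τ / 2 = z + 1 / 2 + τ / 2 + τ by ring, jacobiTheta₂_add_left',
    ← mul_assoc, ← mul_assoc, ← Complex.exp_add, neg_eq_neg_one_mul (cexp _),
    ← Complex.exp_pi_mul_I, ← Complex.exp_add, ← Complex.exp_add]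
  congr 1
  rw [Complex.exp_eq_exp_iff_exists_int]
  exact ⟨-1, by push_cast; ring⟩

lemma theta1_zero : theta1 0 τ = 0 := by
  have h1 := jacobiTheta₂_add_left' (-(1 / 2 + τ / 2)) τ
  have h2 := jacobiTheta₂_add_left (-(1 / 2 + τ / 2) + τ) τ
  rw [show -(1 / 2 + τ / 2) + τ + 1 = 1 / 2 + τ / 2 by ring, h1, jacobiTheta₂_neg_left,
    show -(Real.pi : ℂ) * I * (τ + 2 * -(1 / 2 + τ / 2)) = Real.pi * I by ring,
    Complex.exp_pi_mul_I] at h2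
  rw [theta1_eq_jacobiTheta₂, zero_add]
  have : jacobiTheta₂ (1 / 2 + τ / 2) τ = 0 := by linear_combination h2 / 2
  rw [this, mul_zero]

lemma one_mem_quasiPeriods_theta1 : (1 : ℂ) ∈ quasiPeriods fun z => theta1 z τ :=
  ⟨fun _ => -1, by fun_prop, by simp, fun z => by simp [theta1_add_one]⟩

lemma tau_mem_quasiPeriods_theta1 : τ ∈ quasiPeriods fun z => theta1 z τ :=
  ⟨fun z => -cexp (-(Real.pi * I * (τ + 2 * z))), by fun_prop, by simp, theta1_add_tau⟩

lemma theta1_eq_zero_of_mem_lattice {z : ℂ} (hz : z ∈ lattice τ) : theta1 z τ = 0 :=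
  eq_zero_of_mem_quasiPeriods (H := fun z => theta1 z τ)
    (mem_of_mem_lattice one_mem_quasiPeriods_theta1 tau_mem_quasiPeriods_theta1 hz) theta1_zero

/-- A weak form of the Jacobi triple product identity. -/
lemma exists_theta1_mul_exp_eq_const_mul_thetaProd (hτ : 0 < τ.im) :
    ∃ C : ℂ, ∀ z, theta1 z τ * cexp (Real.pi * I * z) = C * thetaProd τ z := by
  have hθ := differentiable_theta1 hτ
  have hR := differentiable_thetaProd hτ
  obtain ⟨F, hF, hFR⟩ := exists_entire_quotient (G := fun z => theta1 z τ * cexp (Real.pi * I * z))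
    (by fun_prop) hR fun z hz => by
      have hz' := mem_lattice_of_thetaProd_eq_zero hτ hz
      exact ⟨by simp [theta1_eq_zero_of_mem_lattice hz'], deriv_thetaProd_ne_zero hτ hz'⟩
  refine ⟨F 0, fun z => ?_⟩
  rw [hFR, eq_const_of_doubly_periodic hτ hF _ _ z]
  · refine congrFun (eq_of_mul_eq_mul_of_zeros_countable (T := thetaProd τ)
      (hF.continuous.comp (by fun_prop : Continuous fun z : ℂ => z + 1)) hF.continuous
      (countable_lattice τ) (fun z => mem_lattice_of_thetaProd_eq_zero hτ) fun z => ?_)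
    rw [← hFR, ← thetaProd_add_one, ← hFR, theta1_add_one, mul_add,
      Complex.exp_add, mul_one, Complex.exp_pi_mul_I]
    ring
  · refine congrFun (eq_of_mul_eq_mul_of_zeros_countable (T := thetaProd τ)
      (hF.continuous.comp (by fun_prop : Continuous fun z : ℂ => z + τ)) hF.continuous
      (countable_lattice τ) (fun z => mem_lattice_of_thetaProd_eq_zero hτ) fun z => ?_)
    refine mul_left_cancel₀ (neg_ne_zero.2 (Complex.exp_ne_zero (-(2 * Real.pi * I * z)))) ?_
    rw [mul_left_comm, ← thetaProd_add_tau hτ, ← hFR, ← hFR, theta1_add_tau]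
    have h : cexp (-(Real.pi * I * (τ + 2 * z))) * cexp (Real.pi * I * (z + τ)) =
        cexp (-(2 * Real.pi * I * z)) * cexp (Real.pi * I * z) := by
      rw [← Complex.exp_add, ← Complex.exp_add]
      ring_nf
    linear_combination -theta1 z τ * h

lemma mem_lattice_of_theta1_eq_zero (hτ : 0 < τ.im) (h0 : theta1'0 τ ≠ 0) {z : ℂ}
    (hz : theta1 z τ = 0) : z ∈ lattice τ := by
  obtain ⟨C, hC⟩ := exists_theta1_mul_exp_eq_const_mul_thetaProd hτ
  refine mem_lattice_of_thetaProd_eq_zero hτ ((mul_eq_zero (a := C)).1 ?_ |>.resolve_left ?_)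
  · rw [← hC, hz, zero_mul]
  · rintro rfl
    apply h0
    have h : (fun w => theta1 w τ) = fun _ => 0 := funext fun w => by simpa using hC w
    rw [theta1'0, h, deriv_const]

lemma deriv_theta1_ne_zero (hτ : 0 < τ.im) (h0 : theta1'0 τ ≠ 0) {z : ℂ} (hz : z ∈ lattice τ) :
    deriv (fun z => theta1 z τ) z ≠ 0 :=
  deriv_ne_zero_of_mem_quasiPeriods (differentiable_theta1 hτ)
    (mem_of_mem_lattice one_mem_quasiPeriods_theta1 tau_mem_quasiPeriods_theta1 hz) theta1_zero h0

end theta1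

lemma VkSet.apply_sub_one {τ : ℂ} {k : ℕ} {f : ℂ → ℂ} (hf : f ∈ VkSet τ k) (z : ℂ) :
    f (z - 1) = f z := by
  simpa using (hf.2.1 (z - 1)).symm

lemma VkSet.apply_sub_tau {τ : ℂ} {k : ℕ} {f : ℂ → ℂ} (hf : f ∈ VkSet τ k) (z : ℂ) :
    f (z - τ) = cexp (2 * Real.pi * I * k * z - Real.pi * I * k * τ) * f z := by
  have h := hf.2.2 (z - τ)
  rw [sub_add_cancel] at h
  rw [h, ← mul_assoc, ← Complex.exp_add]
  ring_nf
  simp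

/-- the modified type-I elliptic K-operator
K_k(ξ)f(z) = σ_{2ξ}(z+(ξ+ν)/k)f(z+2ξ/k) − σ_{2ν}(z+(ξ+ν)/k)f(−z−2ν/k)
preserves V_k: for f ∈ V_k, K_k(ξ)f extends to an entire function lying in V_k. -/
theorem modified_KI_preserves_Vk (τ : ℂ) (hτ : 0 < τ.im) (k : ℕ) (hk : 0 < k)
    (ξ ν : ℂ) (hξ : 2 * ξ ∉ lattice τ) (hν : 2 * ν ∉ lattice τ)
    (f : ℂ → ℂ) (hf : f ∈ VkSet τ k) :
    ∃ F ∈ VkSet τ k,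
      ∀ z, z + (ξ + ν) / k ∉ lattice τ →
        F z =
          sigmaE τ (2 * ξ) (z + (ξ + ν) / k) * f (z + 2 * ξ / k) -
          sigmaE τ (2 * ν) (z + (ξ + ν) / k) * f (-z - 2 * ν / k) := by
  have hk0 : (k : ℂ) ≠ 0 := Nat.cast_ne_zero.2 hk.ne'
  by_cases h0 : theta1'0 τ = 0
  · exact ⟨fun _ => 0, ⟨by fun_prop, by simp, by simp⟩, fun z _ => by simp [sigmaE, h0]⟩
  have hθ := differentiable_theta1 hτ
  have hfd : Differentiable ℂ f := hf.1
  have hneg : ∀ {w : ℂ}, w ∉ lattice τ → theta1 (-w) τ ≠ 0 := fun hw h => by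
    obtain ⟨m, n, hmn⟩ := mem_lattice_of_theta1_eq_zero hτ h0 h
    exact hw ⟨-m, -n, by push_cast; linear_combination -hmn⟩
  obtain ⟨d, hd⟩ : ∃ d : ℂ, d = (ξ - ν) / k := ⟨_, rfl⟩
  have hkd : (k : ℂ) * d = ξ - ν := by rw [hd]; field_simp
  -- `θ₁ · K_k(ξ) f` as a function of `w = z + (ξ + ν) / k`
  let G : ℂ → ℂ := fun w =>
    theta1'0 τ / theta1 (-(2 * ξ)) τ * theta1 (w - 2 * ξ) τ * f (w + d) -
      theta1'0 τ / theta1 (-(2 * ν)) τ * theta1 (w - 2 * ν) τ * f (-w + d)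
  have hθc : ∀ c : ℂ, Differentiable ℂ fun w => theta1 (w - c) τ := fun c =>
    hθ.comp (f := fun w => w - c) (by fun_prop)
  have hG : Differentiable ℂ G := by
    have h1 := hθc (2 * ξ)
    have h2 := hθc (2 * ν)
    fun_prop
  have hG0 : G 0 = 0 := by
    simp only [G, zero_sub, zero_add, neg_zero]
    rw [div_mul_cancel₀ _ (hneg hξ), div_mul_cancel₀ _ (hneg hν), sub_self]
  have hG1 : ∀ w, G (w + 1) = -1 * G w := fun w => by
    simp only [G]
    rw [show w + 1 - 2 * ξ = w - 2 * ξ + 1 by ring, show w + 1 - 2 * ν = w - 2 * ν + 1 by ring,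
      show w + 1 + d = w + d + 1 by ring, show -(w + 1) + d = -w + d - 1 by ring,
      theta1_add_one, theta1_add_one, hf.2.1, VkSet.apply_sub_one hf]
    ring
  have hGτ : ∀ w, G (w + τ) = -cexp (-(Real.pi * I * (τ + 2 * w)) +
      (-2 * Real.pi * I * (k * w - (ξ + ν)) - Real.pi * I * k * τ)) * G w := fun w => by
    simp only [G]
    rw [show w + τ - 2 * ξ = w - 2 * ξ + τ by ring, show w + τ - 2 * ν = w - 2 * ν + τ by ring,
      show w + τ + d = w + d + τ by ring, show -(w + τ) + d = -w + d - τ by ring,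
      theta1_add_tau, theta1_add_tau, hf.2.2, VkSet.apply_sub_tau hf]
    have e1 : cexp (-(Real.pi * I * (τ + 2 * (w - 2 * ξ)))) *
        cexp (-2 * Real.pi * I * k * (w + d) - Real.pi * I * k * τ) =
        cexp (-(Real.pi * I * (τ + 2 * w)) +
          (-2 * Real.pi * I * (k * w - (ξ + ν)) - Real.pi * I * k * τ)) := by
      rw [← Complex.exp_add]
      congr 1
      linear_combination -2 * Real.pi * I * hkd
    have e2 : cexp (-(Real.pi * I * (τ + 2 * (w - 2 * ν)))) *
        cexp (2 * Real.pi * I * k * (-w + d) - Real.pi * I * k * τ) =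
        cexp (-(Real.pi * I * (τ + 2 * w)) +
          (-2 * Real.pi * I * (k * w - (ξ + ν)) - Real.pi * I * k * τ)) := by
      rw [← Complex.exp_add]
      congr 1
      linear_combination 2 * Real.pi * I * hkd
    linear_combination
      -(theta1'0 τ / theta1 (-(2 * ξ)) τ * theta1 (w - 2 * ξ) τ * f (w + d)) * e1 +
      theta1'0 τ / theta1 (-(2 * ν)) τ * theta1 (w - 2 * ν) τ * f (-w + d) * e2
  have hzero : ∀ w ∈ lattice τ, G w = 0 := fun w hw =>
    eq_zero_of_mem_quasiPeriods (mem_of_mem_lattice ⟨_, by fun_prop, by simp, hG1⟩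
      ⟨_, by fun_prop, by simp, hGτ⟩ hw) hG0
  obtain ⟨F, hF, hFG⟩ := exists_entire_quotient hG hθ fun w hw => by
    have hw' := mem_lattice_of_theta1_eq_zero hτ h0 hw
    exact ⟨hzero w hw', deriv_theta1_ne_zero hτ h0 hw'⟩
  have hF1 : (fun w => F (w + 1)) = F := by
    have hc := hF.continuous
    refine eq_of_mul_eq_mul_of_zeros_countable (T := fun w => theta1 w τ) (by fun_prop) hc
      (countable_lattice τ) (fun z => mem_lattice_of_theta1_eq_zero hτ h0) fun w => ?_
    have h := hG1 w
    rw [hFG, hFG, theta1_add_one] at h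
    linear_combination -h
  have hFτ : (fun w => F (w + τ)) = fun w =>
      cexp (-2 * Real.pi * I * (k * w - (ξ + ν)) - Real.pi * I * k * τ) * F w := by
    have hc := hF.continuous
    refine eq_of_mul_eq_mul_of_zeros_countable (T := fun w => theta1 w τ) (by fun_prop)
      (by fun_prop) (countable_lattice τ) (fun z => mem_lattice_of_theta1_eq_zero hτ h0)
      fun w => ?_
    refine mul_left_cancel₀ (Complex.exp_ne_zero (-(Real.pi * I * (τ + 2 * w)))) ?_
    have h := hGτ w
    rw [hFG, hFG, theta1_add_tau, Complex.exp_add] at h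
    linear_combination -h
  refine ⟨fun z => F (z + (ξ + ν) / k), ⟨by fun_prop, fun z => ?_, fun z => ?_⟩, fun z hz => ?_⟩
  · dsimp only
    rw [add_right_comm]
    exact congrFun hF1 _
  · dsimp only
    rw [add_right_comm]
    refine (congrFun hFτ _).trans ?_
    congr 2
    field_simp
    ring
  · have hne : theta1 (z + (ξ + ν) / k) τ ≠ 0 :=
      fun h => hz (mem_lattice_of_theta1_eq_zero hτ h0 h)
    refine mul_right_cancel₀ hne ((hFG _).symm.trans ?_)
    simp only [G, sigmaE]
    rw [show z + (ξ + ν) / k + d = z + 2 * ξ / k by rw [hd]; ring,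
      show -(z + (ξ + ν) / k) + d = -z - 2 * ν / k by rw [hd]; ring]
    have hξ' := hneg hξ
    have hν' := hneg hν
    generalize z + (ξ + ν) / k = w at hne ⊢
    generalize z + 2 * ξ / k = u
    generalize -z - 2 * ν / k = v
    field_simp
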